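/- There exists an absolute constant C > 0 such that the following holds. Let m, n ≥ 1 and d ≥ 2 be integers with d ≤ m+1 and |Q^m_{≤d}| ≤ m^d, let K > 0, λ > 0, ε ∈ (0,1), δ ∈ (0,1), let τ > 0 with τ·√m ≥ 1, let l = max_{1≤j≤m+1} |Ω_j|, and set σ = 2·m^{d/2}·√(ln(1.25/δ))/ε. Let φ : ℝ → ℝ be continuous and K-Lipschitz. Consider the mechanism Gen_{d,σ} that, on input a dataset D_r of size n over m+1 attributes, draws independent Z_q[t] ∼ N(0,σ²) for q ∈ Q^m_{≤d}, t ∈ Ω_q, sets ĥ_q = M_q(D_r) + Z_q, and outputs (via a fixed measurable selection) a dataset D_s of size n over the same domains minimizing max_{q∈Q^m_{≤d}} ‖ĥ_q − M_q(D)‖₁ over all datasets D of size n. Then: (a) Gen_{d,σ} is (ε,δ)-differentially private; and (b) with probability at least 1 − 2^{−λ} over the noise, |L(w_s,D_r) − L(w_r,D_r)| ≤ C·( K·τ·√(m/(d−1)) + (1/n)·(K·τ·√m + |φ(0)|)·(3m·max{1,τ})^{d−1}·2·l^d·√(2·(ln(2)·(1+λ) + d·ln(m·l)))·σ ), where w_r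 minimizes L(·,D_r) and w_s minimizes L(·,D_s) over the ball {w ∈ ℝ^m : ‖w‖₂ ≤ τ}. -/

import Mathlib

noncomputable section
open Finset MeasureTheory ProbabilityTheory Real

def ValidDomains (m : ℕ) (Ω : Fin (m+1) → Finset ℝ) : Prop :=
  (∀ j, (Ω j : Set ℝ) ⊆ Set.Icc (-1 : ℝ) 1) ∧ Ω (Fin.last m) = ({-1, 1} : Finset ℝ)

def ValidDataset {m n : ℕ} (Ω : Fin (m+1) → Finset ℝ) (D : Fin n → Fin (m+1) → ℝ) : Prop :=
  ∀ i j, D i j ∈ Ω j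

def marginal {m n : ℕ} (D : Fin n → Fin (m+1) → ℝ) (q : Finset (Fin (m+1)))
    (t : ∀ j ∈ q, ℝ) : ℝ :=
  Nat.card {i : Fin n // ∀ j (h : j ∈ q), D i j = t j h}

def margL1 {m n : ℕ} (Ω : Fin (m+1) → Finset ℝ) (Dr Ds : Fin n → Fin (m+1) → ℝ)
    (q : Finset (Fin (m+1))) : ℝ :=
  ∑ t ∈ q.pi Ω, |marginal Dr q t - marginal Ds q t|

def margin {m : ℕ} (w : EuclideanSpace ℝ (Fin m)) (v : Fin (m+1) → ℝ) : ℝ :=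
  (∑ j : Fin m, w j * v j.castSucc) * v (Fin.last m)

def risk {m n : ℕ} (φ : ℝ → ℝ) (w : EuclideanSpace ℝ (Fin m))
    (D : Fin n → Fin (m+1) → ℝ) : ℝ :=
  (1 / n) * ∑ i, φ (margin w (D i))

def MargIdx (m d : ℕ) (Ω : Fin (m+1) → Finset ℝ) : Type :=
  Σ q : {q : Finset (Fin (m+1)) // q.Nonempty ∧ q.card ≤ d},
    {t : ∀ j ∈ (q : Finset (Fin (m+1))), ℝ // t ∈ (q : Finset (Fin (m+1))).pi Ω}

instance (m d : ℕ) (Ω : Fin (m+1) → Finset ℝ) : Fintype (MargIdx m d Ω) := by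
  unfold MargIdx; infer_instance

def Adjacent {m n : ℕ} (D D' : Fin n → Fin (m+1) → ℝ) : Prop :=
  ∃ i₀ : Fin n, (∀ i : Fin n, i ≠ i₀ → D i = D' i) ∧ D i₀ ≠ D' i₀

def noiseMeasure (m d : ℕ) (Ω : Fin (m+1) → Finset ℝ) (σ : ℝ) :
    Measure (MargIdx m d Ω → ℝ) :=
  Measure.pi fun _ => gaussianReal 0 (Real.toNNReal (σ ^ 2))

/-- The vector of true marginals of `D`, indexed by `MargIdx`. -/
def margVec {m n d : ℕ} (Ω : Fin (m+1) → Finset ℝ) (D : Fin n → Fin (m+1) → ℝ)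
    (p : MargIdx m d Ω) : ℝ :=
  marginal D (p.1 : Finset (Fin (m+1))) p.2.1

/-- `max_{q ∈ Q^m_{≤d}} ‖h_q − M_q(D)‖₁` for a vector `h` of (noisy) marginals. -/
def maxDistToMarginals {m n d : ℕ} (Ω : Fin (m+1) → Finset ℝ)
    (h : MargIdx m d Ω → ℝ) (D : Fin n → Fin (m+1) → ℝ) : ℝ :=
  sSup {r : ℝ | ∃ q : {q : Finset (Fin (m+1)) // q.Nonempty ∧ q.card ≤ d},
    r = ∑ t ∈ ((q : Finset (Fin (m+1))).pi Ω).attach,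
      |h ⟨q, t⟩ - marginal D (q : Finset (Fin (m+1))) t.1|}

section GaussianNoise

open scoped NNReal ENNReal

theorem gaussianReal_eq_withDensity_exp (a : ℝ) {v : ℝ≥0} (hv : v ≠ 0) :
    gaussianReal a v = (gaussianReal 0 v).withDensity
      (fun x => ENNReal.ofReal (exp ((a * x - a ^ 2 / 2) / v))) := by
  rw [gaussianReal_of_var_ne_zero _ hv, gaussianReal_of_var_ne_zero _ hv,
    ← withDensity_mul _ (measurable_gaussianPDF 0 v) (by fun_prop)]
  congr 1
  ext x
  have hv' : (v : ℝ) ≠ 0 := by exact_mod_cast hv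
  rw [Pi.mul_apply, gaussianPDF, gaussianPDF, ← ENNReal.ofReal_mul (gaussianPDFReal_nonneg _ _ _)]
  congr 1
  rw [gaussianPDFReal, gaussianPDFReal, mul_assoc (√(2 * π * v))⁻¹, ← exp_add]
  congr 2
  field_simp
  ring

theorem pi_withDensity_eq {ι : Type*} [Fintype ι] {X : ι → Type*} [∀ i, MeasurableSpace (X i)]
    (μ : ∀ i, Measure (X i)) [∀ i, IsProbabilityMeasure (μ i)] (f : ∀ i, X i → ℝ≥0∞)
    (hf : ∀ i, Measurable (f i)) [∀ i, SigmaFinite ((μ i).withDensity (f i))] :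
    Measure.pi (fun i => (μ i).withDensity (f i)) =
      (Measure.pi μ).withDensity (fun x => ∏ i, f i (x i)) := by
  refine Measure.pi_eq fun s hs => ?_
  rw [withDensity_apply _ (MeasurableSet.univ_pi hs),
    ← lintegral_indicator (MeasurableSet.univ_pi hs)]
  have h1 : (Set.univ.pi s).indicator (fun x => ∏ i, f i (x i)) =
      fun x => ∏ i, (s i).indicator (f i) (x i) := by
    ext x
    by_cases hx : x ∈ Set.univ.pi s
    · rw [Set.indicator_of_mem hx]
      exact prod_congr rfl fun i _ => (Set.indicator_of_mem (hx i trivial) _).symm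
    · rw [Set.indicator_of_notMem hx]
      simp only [Set.mem_univ_pi, not_forall] at hx
      obtain ⟨i, hi⟩ := hx
      exact (prod_eq_zero (mem_univ i) (Set.indicator_of_notMem hi _)).symm
  rw [h1, lintegral_prod_eq_prod_lintegral_of_indepFun univ
    (fun i (x : ∀ i, X i) => (s i).indicator (f i) (x i))
    (iIndepFun_pi fun i => ((hf i).indicator (hs i)).aemeasurable)
    (fun i => ((hf i).indicator (hs i)).comp (measurable_pi_apply i))]
  refine prod_congr rfl fun i _ => ?_
  rw [withDensity_apply _ (hs i), ← lintegral_indicator (hs i),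
    ← (measurePreserving_eval μ i).map_eq, lintegral_map ((hf i).indicator (hs i))
      (measurable_pi_apply i)]

theorem gaussianReal_Iio_neg (v : ℝ≥0) (u : ℝ) :
    gaussianReal 0 v (Set.Iio (-u)) = gaussianReal 0 v (Set.Ioi u) := by
  conv_rhs => rw [← neg_zero, ← gaussianReal_map_neg,
    Measure.map_apply measurable_neg measurableSet_Ioi]
  simp

theorem gaussianReal_Ioi_zero_le (v : ℝ≥0) :
    gaussianReal 0 v (Set.Ioi 0) ≤ ENNReal.ofReal (1 / 2) := by
  have h : gaussianReal 0 v (Set.Iio 0) = gaussianReal 0 v (Set.Ioi 0) := by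
    simpa using gaussianReal_Iio_neg v 0
  have h2 : gaussianReal 0 v (Set.Iio 0) + gaussianReal 0 v (Set.Ioi 0) ≤ 1 := by
    have hd : Disjoint (Set.Iio (0 : ℝ)) (Set.Ioi 0) :=
      Set.disjoint_left.2 fun x hx hx' => lt_asymm (Set.mem_Iio.1 hx) hx'
    rw [← measure_union hd measurableSet_Ioi]
    exact prob_le_one
  rw [h] at h2
  have hfin : gaussianReal 0 v (Set.Ioi 0) ≠ ⊤ := measure_ne_top _ _
  rw [← ENNReal.ofReal_toReal hfin] at h2 ⊢
  rw [← ENNReal.ofReal_add ENNReal.toReal_nonneg ENNReal.toReal_nonneg, ← ENNReal.ofReal_one,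
    ENNReal.ofReal_le_ofReal_iff zero_le_one] at h2
  exact ENNReal.ofReal_le_ofReal (by linarith)

theorem gaussianReal_Ioi_le {v : ℝ≥0} (hv : v ≠ 0) {u : ℝ} (hu : 0 ≤ u) :
    gaussianReal 0 v (Set.Ioi u) ≤ ENNReal.ofReal (exp (-u ^ 2 / (2 * v)) / 2) := by
  have h1 : gaussianReal 0 v (Set.Ioi u) = gaussianReal (-u) v (Set.Ioi 0) := by
    rw [show -u = 0 + -u by ring, ← gaussianReal_map_add_const,
      Measure.map_apply (by fun_prop) measurableSet_Ioi]
    congr 1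
    ext x
    simp
  rw [h1, gaussianReal_eq_withDensity_exp _ hv, withDensity_apply _ measurableSet_Ioi]
  calc ∫⁻ x in Set.Ioi 0, ENNReal.ofReal (exp ((-u * x - (-u) ^ 2 / 2) / v)) ∂gaussianReal 0 v
      ≤ ∫⁻ x in Set.Ioi 0, ENNReal.ofReal (exp (-u ^ 2 / (2 * v))) ∂gaussianReal 0 v := by
        refine setLIntegral_mono (by fun_prop) fun x hx => ?_
        refine ENNReal.ofReal_le_ofReal (exp_le_exp.2 ?_)
        rw [← div_div]
        refine div_le_div_of_nonneg_right ?_ v.coe_nonneg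
        nlinarith [mul_nonneg hu (le_of_lt hx)]
    _ = ENNReal.ofReal (exp (-u ^ 2 / (2 * v))) * gaussianReal 0 v (Set.Ioi 0) := by simp
    _ ≤ ENNReal.ofReal (exp (-u ^ 2 / (2 * v))) * ENNReal.ofReal (1 / 2) := by
        gcongr
        exact gaussianReal_Ioi_zero_le v
    _ = _ := by rw [← ENNReal.ofReal_mul (exp_pos _).le, mul_one_div]

theorem gaussianReal_Ioi_le_half_add {v : ℝ≥0} (hv : v ≠ 0) {u c : ℝ} (hu : u ≤ 0) (hc : 0 ≤ c)
    (hcu : -u ≤ c * √v) :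
    gaussianReal 0 v (Set.Ioi u) ≤ ENNReal.ofReal (1 / 2 + c) := by
  have hv' : (0 : ℝ) < v := by positivity
  rw [← Set.Ioc_union_Ioi_eq_Ioi hu, ENNReal.ofReal_add (by norm_num) hc, add_comm]
  refine (measure_union_le _ _).trans (add_le_add ?_ (gaussianReal_Ioi_zero_le v))
  rw [gaussianReal_apply _ hv]
  calc ∫⁻ x in Set.Ioc u 0, gaussianPDF 0 v x
      ≤ ∫⁻ x in Set.Ioc u 0, ENNReal.ofReal (√v)⁻¹ := by
        refine setLIntegral_mono (by fun_prop) fun x _ => ENNReal.ofReal_le_ofReal ?_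
        rw [gaussianPDFReal]
        have h1 : (√(2 * π * v))⁻¹ ≤ (√v)⁻¹ := by
          gcongr
          nlinarith [pi_gt_three]
        have h2 : exp (-(x - 0) ^ 2 / (2 * v)) ≤ 1 :=
          exp_le_one_iff.2 (div_nonpos_of_nonpos_of_nonneg (by nlinarith [sq_nonneg (x - 0)])
            (by positivity))
        exact (mul_le_of_le_one_right (by positivity) h2).trans h1
    _ = ENNReal.ofReal ((√v)⁻¹ * (-u)) := by
        rw [setLIntegral_const, Real.volume_Ioc, ← ENNReal.ofReal_mul (by positivity)]
        simp
    _ ≤ _ := by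
        refine ENNReal.ofReal_le_ofReal ?_
        rw [inv_mul_le_iff₀ (by positivity)]
        linarith

theorem map_sum_mul_pi_gaussianReal {ι : Type*} [Fintype ι] (a : ι → ℝ) (v : ℝ≥0) :
    (Measure.pi fun _ : ι => gaussianReal 0 v).map (fun z => ∑ i, a i * z i) =
      gaussianReal 0 (v * Real.toNNReal (∑ i, a i ^ 2)) := by
  have hm : ∀ i : ι, MemLp (fun x : ℝ => a i * x) 2 (gaussianReal 0 v) := fun i =>
    (memLp_id_gaussianReal 2).const_mul (a i)
  have hind : iIndepFun (fun i (z : ι → ℝ) => z i) (Measure.pi fun _ : ι => gaussianReal 0 v) :=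
    iIndepFun_pi (X := fun _ x => x) fun i => aemeasurable_id
  have hev : ∀ i : ι, (Measure.pi fun _ : ι => gaussianReal 0 v).map (fun z => z i) =
      gaussianReal 0 v := fun i => (measurePreserving_eval _ i).map_eq
  have hg : HasGaussianLaw (fun z : ι → ℝ => (fun i => z i))
      (Measure.pi fun _ : ι => gaussianReal 0 v) :=
    iIndepFun.hasGaussianLaw (X := fun i (z : ι → ℝ) => z i)
      (fun i => ⟨by rw [hev]; infer_instance⟩) hind
  have hg2 := hg.map_fun (∑ i, a i • ContinuousLinearMap.proj (R := ℝ) (φ := fun _ : ι => ℝ) i)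
  have he : (fun z : ι → ℝ => (∑ i, a i • ContinuousLinearMap.proj (R := ℝ)
      (φ := fun _ : ι => ℝ) i) (fun i => z i)) = fun z => ∑ i, a i * z i := by
    ext z; simp
  rw [he] at hg2
  rw [hg2.map_eq_gaussianReal]
  have hint : ∀ i, Integrable (fun z : ι → ℝ => a i * z i)
      (Measure.pi fun _ : ι => gaussianReal 0 v) := fun i =>
    (measurePreserving_eval (fun _ : ι => gaussianReal 0 v) i).integrable_comp_of_integrable
      ((hm i).integrable (by norm_num))
  congr 1
  · rw [integral_finsetSum _ fun i _ => hint i]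
    refine sum_eq_zero fun i _ => ?_
    rw [integral_const_mul]
    have := integral_map (μ := Measure.pi fun _ : ι => gaussianReal 0 v) (φ := fun z => z i)
      (measurable_pi_apply i).aemeasurable (f := fun x : ℝ => x) (by fun_prop)
    rw [← this, hev, integral_id_gaussianReal, mul_zero]
  · have := variance_sum_pi hm
    have he2 : (∑ i, fun ω : ι → ℝ => a i * ω i) = fun z => ∑ i, a i * z i := by
      ext z; simp
    rw [he2] at this
    rw [this]
    have h1 : ∀ i, Var[fun x => a i * x; gaussianReal 0 v] = a i ^ 2 * v := fun i => by
      rw [variance_const_mul, variance_fun_id_gaussianReal]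
    simp only [h1]
    rw [← sum_mul, mul_comm, Real.toNNReal_mul v.coe_nonneg, Real.toNNReal_coe]

theorem pi_gaussianReal_shift_le {ι : Type*} [Fintype ι] (a : ι → ℝ) {v : ℝ≥0} (hv : v ≠ 0)
    {ε : ℝ} {T : Set (ι → ℝ)} (hT : MeasurableSet T) :
    (Measure.pi fun _ : ι => gaussianReal 0 v).map (fun z i => z i + a i) T ≤
      ENNReal.ofReal (exp ε) * (Measure.pi fun _ : ι => gaussianReal 0 v) T +
        gaussianReal 0 (v * Real.toNNReal (∑ i, a i ^ 2))
          (Set.Ioi (ε * v - (∑ i, a i ^ 2) / 2)) := by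
  set P := Measure.pi fun _ : ι => gaussianReal 0 v with hP
  have hv' : (0 : ℝ) < v := by positivity
  set B : Set (ι → ℝ) := {x | ∑ i, (a i * x i - a i ^ 2 / 2) / v ≤ ε} with hB
  have hBm : MeasurableSet B := measurableSet_le (by fun_prop) measurable_const
  have hdens : P.map (fun z i => z i + a i) =
      P.withDensity (fun x => ∏ i, ENNReal.ofReal (exp ((a i * x i - a i ^ 2 / 2) / v))) := by
    have : ∀ i, SigmaFinite ((gaussianReal 0 v).withDensity
        (fun x => ENNReal.ofReal (exp ((a i * x - a i ^ 2 / 2) / v)))) := fun i => by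
      rw [← gaussianReal_eq_withDensity_exp (a i) hv]; infer_instance
    rw [hP, Measure.pi_map_pi (f := fun i x => x + a i) fun i => by fun_prop,
      ← pi_withDensity_eq (fun _ => gaussianReal 0 v)
        (fun i x => ENNReal.ofReal (exp ((a i * x - a i ^ 2 / 2) / v))) (fun i => by fun_prop)]
    congr 1
    ext1 i
    rw [gaussianReal_map_add_const, zero_add, gaussianReal_eq_withDensity_exp (a i) hv]
  have h1 : P.map (fun z i => z i + a i) (T ∩ B) ≤ ENNReal.ofReal (exp ε) * P T := by
    rw [hdens, withDensity_apply _ (hT.inter hBm)]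
    calc _ ≤ ∫⁻ x in T ∩ B, ENNReal.ofReal (exp ε) ∂P := by
          refine setLIntegral_mono (by fun_prop) fun x hx => ?_
          rw [← ENNReal.ofReal_prod_of_nonneg fun i _ => (exp_pos _).le, ← exp_sum]
          exact ENNReal.ofReal_le_ofReal (exp_le_exp.2 hx.2)
      _ = ENNReal.ofReal (exp ε) * P (T ∩ B) := by simp
      _ ≤ _ := by gcongr; exact Set.inter_subset_left
  have h2 : P.map (fun z i => z i + a i) Bᶜ = gaussianReal 0 (v * Real.toNNReal (∑ i, a i ^ 2))
      (Set.Ioi (ε * v - (∑ i, a i ^ 2) / 2)) := by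
    rw [← map_sum_mul_pi_gaussianReal, Measure.map_apply (by fun_prop) hBm.compl,
      Measure.map_apply (by fun_prop) measurableSet_Ioi]
    congr 1
    ext z
    simp only [hB, Set.mem_preimage, Set.mem_compl_iff, Set.mem_ofPred_eq, not_le, Set.mem_Ioi]
    rw [← sum_div, lt_div_iff₀ hv', sum_sub_distrib, ← sum_div]
    have : ∑ i, a i * (z i + a i) = ∑ i, a i * z i + ∑ i, a i ^ 2 := by
      rw [← sum_add_distrib]; exact sum_congr rfl fun i _ => by ring
    rw [this]
    constructor <;> intro h <;> linarith
  calc P.map (fun z i => z i + a i) T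
      ≤ P.map (fun z i => z i + a i) (T ∩ B ∪ Bᶜ) := measure_mono fun x hx => by
        by_cases h : x ∈ B
        · exact Or.inl ⟨hx, h⟩
        · exact Or.inr h
    _ ≤ _ := (measure_union_le _ _).trans (add_le_add h1 h2.le)

theorem pi_gaussianReal_shift_le_of_sensitivity {ι : Type*} [Fintype ι] (a : ι → ℝ) {v : ℝ≥0}
    (hv : v ≠ 0) {ε δ : ℝ} (hε : ε ∈ Set.Ioo (0 : ℝ) 1) (hδ : δ ∈ Set.Ioo (0 : ℝ) 1)
    (ha : 2 * log (1.25 / δ) * (∑ i, a i ^ 2) ≤ ε ^ 2 * v)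
    {T : Set (ι → ℝ)} (hT : MeasurableSet T) :
    (Measure.pi fun _ : ι => gaussianReal 0 v).map (fun z i => z i + a i) T ≤
      ENNReal.ofReal (exp ε) * (Measure.pi fun _ : ι => gaussianReal 0 v) T +
        ENNReal.ofReal δ := by
  obtain ⟨hε0, hε1⟩ := hε
  obtain ⟨hδ0, hδ1⟩ := hδ
  have hv' : (0 : ℝ) < v := by positivity
  refine (pi_gaussianReal_shift_le a hv (ε := ε) hT).trans (add_le_add le_rfl ?_)
  set A := ∑ i, a i ^ 2 with hA
  set L := log (1.25 / δ) with hL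
  have hA0 : 0 ≤ A := sum_nonneg fun i _ => sq_nonneg _
  have hδL : δ = 1.25 * exp (-L) := by
    rw [hL, exp_neg, exp_log (by positivity)]; field_simp
  have hL2 : 0.2 ≤ L := by
    have h1 : log 1.25 ≤ L := log_le_log (by norm_num) (by rw [le_div_iff₀ hδ0]; nlinarith)
    have h2 := one_sub_inv_le_log_of_pos (show (0 : ℝ) < 1.25 by norm_num)
    norm_num at h1 h2 ⊢
    linarith
  rcases hA0.eq_or_lt with h0 | hApos
  · rw [← h0]
    simp only [Real.toNNReal_zero, mul_zero, gaussianReal_zero_var]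
    rw [Measure.dirac_apply' _ measurableSet_Ioi, Set.indicator_of_notMem]
    · exact zero_le
    · simp; positivity
  have hw : v * Real.toNNReal A ≠ 0 := mul_ne_zero hv (by simpa using hApos)
  have hwc : ((v * Real.toNNReal A : ℝ≥0) : ℝ) = v * A := by
    rw [NNReal.coe_mul, Real.coe_toNNReal _ hA0]
  rcases le_or_gt 0 (ε * v - A / 2) with hu | hu
  · refine (gaussianReal_Ioi_le hw hu).trans (ENNReal.ofReal_le_ofReal ?_)
    rw [hwc, hδL]
    have h1 : -(ε * v - A / 2) ^ 2 / (2 * (v * A)) ≤ 1 / 2 - L := by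
      rw [div_le_iff₀ (by positivity)]
      nlinarith [mul_le_mul_of_nonneg_right ha hv'.le, mul_pos hv' hApos, sq_nonneg A,
        mul_lt_mul_of_pos_right hε1 (mul_pos hv' hApos)]
    have h2 : exp (1 / 2 - L) ≤ 2.5 * exp (-L) := by
      rw [sub_eq_add_neg, exp_add]
      have h3 : exp (1 / 2) ≤ 2.5 := by
        have h4 : exp (1 / 2) * exp (1 / 2) = exp 1 := by rw [← exp_add]; norm_num
        nlinarith [exp_one_lt_three, exp_pos (1 / 2)]
      gcongr
    linarith [exp_le_exp.2 h1]
  · have hLε : 4 * L ≤ ε := by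
      nlinarith
    have hδ2 : 0.9 ≤ δ := by
      have := add_one_le_exp (-L)
      rw [hδL]; linarith
    refine (gaussianReal_Ioi_le_half_add hw hu.le (c := 0.4) (by norm_num) ?_).trans
      (ENNReal.ofReal_le_ofReal (by linarith))
    rw [hwc]
    have h1 : 0.4 * A ≤ ε ^ 2 * v := by nlinarith
    have h2 : A / 2 - ε * v ≤ 0.4 * √(v * A) := by
      rw [← div_le_iff₀' (by norm_num)]
      refine le_sqrt_of_sq_le ?_
      have h3 : ε * ε * v ≤ ε * v := by nlinarith [mul_pos hε0 hv']
      have h4 : A / 4 - ε * v / 2 ≤ 0.16 * v := by nlinarith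
      have h5 : ε * v * (ε * v) ≤ A / 2 * (ε * v) := by nlinarith [mul_pos hε0 hv']
      rw [div_pow, div_le_iff₀ (by norm_num)]
      nlinarith [mul_le_mul_of_nonneg_right h4 hA0]
    linarith

end GaussianNoise

section Marginals

open Classical in
theorem marginal_eq_sum {m n : ℕ} (D : Fin n → Fin (m+1) → ℝ) (q : Finset (Fin (m+1)))
    (t : ∀ j ∈ q, ℝ) :
    marginal D q t = ∑ i, if (fun j (_ : j ∈ q) => D i j) = t then 1 else 0 := by
  rw [marginal, Nat.card_eq_fintype_card, Fintype.card_subtype, sum_boole]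
  congr 2
  ext i
  simp [funext_iff]

theorem sum_pi_mul_marginal {m n : ℕ} {Ω : Fin (m+1) → Finset ℝ} {D : Fin n → Fin (m+1) → ℝ}
    (hD : ValidDataset Ω D) (q : Finset (Fin (m+1))) (f : (∀ j ∈ q, ℝ) → ℝ) :
    ∑ t ∈ q.pi Ω, f t * marginal D q t = ∑ i, f (fun j _ => D i j) := by
  classical
  simp only [marginal_eq_sum, mul_sum]
  rw [sum_comm]
  refine sum_congr rfl fun i _ => ?_
  simp only [mul_ite, mul_one, mul_zero]
  rw [sum_ite_eq, if_pos]
  exact mem_pi.2 fun j _ => hD i j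

theorem abs_sum_sub_sum_le_margL1 {m n : ℕ} {Ω : Fin (m+1) → Finset ℝ}
    {Dr Ds : Fin n → Fin (m+1) → ℝ} (hr : ValidDataset Ω Dr) (hs : ValidDataset Ω Ds)
    (q : Finset (Fin (m+1))) (f : (∀ j ∈ q, ℝ) → ℝ) (hf : ∀ t ∈ q.pi Ω, |f t| ≤ 1) :
    |∑ i, f (fun j _ => Dr i j) - ∑ i, f (fun j _ => Ds i j)| ≤ margL1 Ω Dr Ds q := by
  rw [← sum_pi_mul_marginal hr, ← sum_pi_mul_marginal hs, ← sum_sub_distrib, margL1]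
  refine (abs_sum_le_sum_abs _ _).trans (sum_le_sum fun t ht => ?_)
  rw [← mul_sub, abs_mul]
  exact mul_le_of_le_one_left (abs_nonneg _) (hf t ht)

theorem sum_sq_marginal_sub_le {m n : ℕ} {D D' : Fin n → Fin (m+1) → ℝ} (h : Adjacent D D')
    (q : Finset (Fin (m+1))) (s : Finset (∀ j ∈ q, ℝ)) :
    ∑ t ∈ s, (marginal D q t - marginal D' q t) ^ 2 ≤ 2 := by
  classical
  obtain ⟨i₀, hi, -⟩ := h
  have h1 : ∀ t, marginal D q t - marginal D' q t =
      (if (fun j (_ : j ∈ q) => D i₀ j) = t then 1 else 0) -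
        (if (fun j (_ : j ∈ q) => D' i₀ j) = t then 1 else 0) := fun t => by
    rw [marginal_eq_sum, marginal_eq_sum, ← sum_sub_distrib]
    refine sum_eq_single i₀ (fun i _ hne => ?_) (by simp)
    rw [hi i hne, sub_self]
  calc ∑ t ∈ s, (marginal D q t - marginal D' q t) ^ 2
      ≤ ∑ t ∈ s, ((if (fun j (_ : j ∈ q) => D i₀ j) = t then 1 else 0) +
        (if (fun j (_ : j ∈ q) => D' i₀ j) = t then (1 : ℝ) else 0)) := by
        refine sum_le_sum fun t _ => ?_
        rw [h1]
        split_ifs <;> norm_num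
    _ ≤ 1 + 1 := by
        rw [sum_add_distrib, sum_ite_eq, sum_ite_eq]
        gcongr <;> split_ifs <;> norm_num
    _ = 2 := by norm_num

theorem sum_margIdx {m d : ℕ} (Ω : Fin (m+1) → Finset ℝ) (f : MargIdx m d Ω → ℝ) :
    ∑ p, f p = ∑ q : {q : Finset (Fin (m+1)) // q.Nonempty ∧ q.card ≤ d},
      ∑ t ∈ ((q : Finset (Fin (m+1))).pi Ω).attach, f ⟨q, t⟩ :=
  Fintype.sum_sigma (α := fun q : {q : Finset (Fin (m+1)) // q.Nonempty ∧ q.card ≤ d} =>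
    {t : ∀ j ∈ (q : Finset (Fin (m+1))), ℝ // t ∈ (q : Finset (Fin (m+1))).pi Ω}) f

theorem sum_sq_margVec_sub_le {m n d : ℕ} (Ω : Fin (m+1) → Finset ℝ)
    {D D' : Fin n → Fin (m+1) → ℝ} (h : Adjacent D D') :
    ∑ p : MargIdx m d Ω, (margVec Ω D p - margVec Ω D' p) ^ 2 ≤
      2 * Fintype.card {q : Finset (Fin (m+1)) // q.Nonempty ∧ q.card ≤ d} := by
  rw [sum_margIdx, mul_comm, ← nsmul_eq_mul, ← Finset.card_univ, ← sum_const]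
  refine sum_le_sum fun q _ => ?_
  have := sum_sq_marginal_sub_le h q.1 (q.1.pi Ω)
  rwa [← sum_attach] at this

theorem card_pi_le {m d l : ℕ} {Ω : Fin (m+1) → Finset ℝ} (hl : ∀ j, (Ω j).card ≤ l)
    (hl1 : 1 ≤ l) {q : Finset (Fin (m+1))} (hq : q.card ≤ d) : (q.pi Ω).card ≤ l ^ d := by
  rw [card_pi]
  exact (prod_le_pow_card q _ l fun j _ => hl j).trans (Nat.pow_le_pow_right hl1 hq)

theorem card_margIdx_le {m d l : ℕ} {Ω : Fin (m+1) → Finset ℝ} (hl : ∀ j, (Ω j).card ≤ l)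
    (hl1 : 1 ≤ l) :
    Fintype.card (MargIdx m d Ω) ≤
      Fintype.card {q : Finset (Fin (m+1)) // q.Nonempty ∧ q.card ≤ d} * l ^ d := by
  have h := sum_margIdx (d := d) Ω (fun _ => 1)
  simp only [sum_const, nsmul_eq_mul, mul_one, card_attach, Finset.card_univ] at h
  have h2 : Fintype.card (MargIdx m d Ω) =
      ∑ q : {q : Finset (Fin (m+1)) // q.Nonempty ∧ q.card ≤ d}, (q.1.pi Ω).card := by
    exact_mod_cast h
  rw [h2, ← Finset.card_univ, ← smul_eq_mul, ← sum_const]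
  exact sum_le_sum fun q _ => card_pi_le hl hl1 q.2.2

theorem sum_abs_le_maxDistToMarginals {m n d : ℕ} (Ω : Fin (m+1) → Finset ℝ)
    (h : MargIdx m d Ω → ℝ) (D : Fin n → Fin (m+1) → ℝ)
    (q : {q : Finset (Fin (m+1)) // q.Nonempty ∧ q.card ≤ d}) :
    ∑ t ∈ ((q : Finset (Fin (m+1))).pi Ω).attach,
      |h ⟨q, t⟩ - marginal D (q : Finset (Fin (m+1))) t.1| ≤ maxDistToMarginals Ω h D := by
  refine le_csSup ?_ ⟨q, rfl⟩
  refine Set.Finite.bddAbove ((Set.finite_range fun q : {q : Finset (Fin (m+1)) //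
    q.Nonempty ∧ q.card ≤ d} => ∑ t ∈ ((q : Finset (Fin (m+1))).pi Ω).attach,
      |h ⟨q, t⟩ - marginal D (q : Finset (Fin (m+1))) t.1|).subset ?_)
  rintro r ⟨q, rfl⟩
  exact ⟨q, rfl⟩

theorem maxDistToMarginals_margVec_add_le {m n d l : ℕ} {Ω : Fin (m+1) → Finset ℝ}
    (hl : ∀ j, (Ω j).card ≤ l) (hl1 : 1 ≤ l) (hd : 1 ≤ d) (D : Fin n → Fin (m+1) → ℝ)
    {z : MargIdx m d Ω → ℝ} {T : ℝ} (hT : 0 ≤ T) (hz : ∀ p, |z p| ≤ T) :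
    maxDistToMarginals Ω (fun p => margVec Ω D p + z p) D ≤ l ^ d * T := by
  refine csSup_le ⟨_, ⟨{0}, singleton_nonempty _, by simpa using hd⟩, rfl⟩ ?_
  rintro r ⟨q, rfl⟩
  calc _ ≤ ∑ t ∈ ((q : Finset (Fin (m+1))).pi Ω).attach, T := by
        refine sum_le_sum fun t _ => ?_
        simpa [margVec] using hz ⟨q, t⟩
    _ = ((q : Finset (Fin (m+1))).pi Ω).card * T := by simp
    _ ≤ _ := by
        gcongr
        exact_mod_cast card_pi_le hl hl1 q.2.2

theorem margL1_le_of_minimizer {m n d l : ℕ} {Ω : Fin (m+1) → Finset ℝ}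
    (hl : ∀ j, (Ω j).card ≤ l) (hl1 : 1 ≤ l) (hd : 1 ≤ d) {Dr Ds : Fin n → Fin (m+1) → ℝ}
    {z : MargIdx m d Ω → ℝ} {T : ℝ} (hT : 0 ≤ T) (hz : ∀ p, |z p| ≤ T)
    (hmin : maxDistToMarginals Ω (fun p => margVec Ω Dr p + z p) Ds ≤
      maxDistToMarginals Ω (fun p => margVec Ω Dr p + z p) Dr)
    {q : Finset (Fin (m+1))} (hq : q.Nonempty) (hqd : q.card ≤ d) :
    margL1 Ω Dr Ds q ≤ 2 * l ^ d * T := by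
  have h1 := sum_abs_le_maxDistToMarginals Ω (fun p => margVec Ω Dr p + z p) Dr ⟨q, hq, hqd⟩
  have h2 := sum_abs_le_maxDistToMarginals Ω (fun p => margVec Ω Dr p + z p) Ds ⟨q, hq, hqd⟩
  have h3 := maxDistToMarginals_margVec_add_le hl hl1 hd Dr hT hz
  have h4 : margL1 Ω Dr Ds q ≤ ∑ t ∈ (q.pi Ω).attach,
        |margVec Ω Dr ⟨⟨q, hq, hqd⟩, t⟩ + z ⟨⟨q, hq, hqd⟩, t⟩ - marginal Dr q t.1| +
      ∑ t ∈ (q.pi Ω).attach,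
        |margVec Ω Dr ⟨⟨q, hq, hqd⟩, t⟩ + z ⟨⟨q, hq, hqd⟩, t⟩ - marginal Ds q t.1| := by
    rw [margL1, ← sum_attach, ← sum_add_distrib]
    refine sum_le_sum fun t _ => ?_
    generalize margVec Ω Dr ⟨⟨q, hq, hqd⟩, t⟩ + z ⟨⟨q, hq, hqd⟩, t⟩ = y
    rw [abs_sub_comm y]
    exact abs_sub_le _ _ _
  linarith

end Marginals

section BernsteinApproximation

theorem sum_abs_sub_mul_bernstein_le {N : ℕ} (hN : N ≠ 0) (x : unitInterval) :
    ∑ k : Fin (N + 1), |(x : ℝ) - k / N| * bernstein N k x ≤ 1 / (2 * √N) := by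
  have hN' : (0 : ℝ) < N := by positivity
  have h1 := sum_mul_sq_le_sq_mul_sq univ
    (fun k : Fin (N + 1) => |(x : ℝ) - k / N| * √(bernstein N k x))
    (fun k : Fin (N + 1) => √(bernstein N k x))
  have h2 : ∀ k : Fin (N + 1), √(bernstein N k x) * √(bernstein N k x) = bernstein N k x :=
    fun k => mul_self_sqrt bernstein_nonneg
  simp only [mul_assoc, h2, mul_pow, sq_abs, sq √(bernstein _ _ _)] at h1
  rw [bernstein.probability, mul_one] at h1
  have h3 := bernstein.variance hN x
  simp only [bernstein.z] at h3
  rw [h3] at h1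
  have h4 : (x : ℝ) * (1 - x) / N ≤ (1 / (2 * √N)) ^ 2 := by
    rw [div_pow, mul_pow, sq_sqrt hN'.le, div_le_div_iff₀ hN' (by positivity)]
    nlinarith [mul_nonneg hN'.le (sq_nonneg (2 * (x : ℝ) - 1))]
  exact le_of_sq_le_sq (h1.trans h4) (by positivity)

theorem abs_sub_bernstein_sum_le {φ : ℝ → ℝ} {K R s : ℝ} (hK : 0 ≤ K)
    (hφ : ∀ x y, |φ x - φ y| ≤ K * |x - y|) (hR : 0 < R) (hs : |s| ≤ R) {N : ℕ} (hN : N ≠ 0) :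
    |φ s - ∑ k : Fin (N + 1), φ (R * (2 * (k / N) - 1)) *
      (N.choose k * (((1 + s / R) / 2) ^ (k : ℕ) * ((1 - s / R) / 2) ^ (N - k)))| ≤
      K * R / √N := by
  obtain ⟨hs1, hs2⟩ := abs_le.1 hs
  have hx : (1 + s / R) / 2 ∈ unitInterval := by
    have h1 : -1 ≤ s / R := by rw [le_div_iff₀ hR]; linarith
    have h2 : s / R ≤ 1 := by rw [div_le_iff₀ hR]; linarith
    constructor <;> linarith
  set x : unitInterval := ⟨(1 + s / R) / 2, hx⟩ with hxd
  have hxs : s = R * (2 * (x : ℝ) - 1) := by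
    rw [hxd]; field_simp; ring
  have hb : ∀ k : Fin (N + 1), (N.choose k : ℝ) * (((1 + s / R) / 2) ^ (k : ℕ) *
      ((1 - s / R) / 2) ^ (N - k)) = bernstein N k x := fun k => by
    rw [bernstein_apply, hxd, mul_assoc]
    congr 3
    ring
  simp only [hb]
  have h1 : φ s = ∑ k : Fin (N + 1), φ s * bernstein N k x := by
    rw [← mul_sum, bernstein.probability, mul_one]
  rw [h1, ← sum_sub_distrib]
  calc |∑ k : Fin (N + 1), (φ s * bernstein N k x -
        φ (R * (2 * (k / N) - 1)) * bernstein N k x)|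
      ≤ ∑ k : Fin (N + 1), K * (2 * R) * (|(x : ℝ) - k / N| * bernstein N k x) := by
        refine (abs_sum_le_sum_abs _ _).trans (sum_le_sum fun k _ => ?_)
        rw [← sub_mul, abs_mul, abs_of_nonneg bernstein_nonneg, ← mul_assoc]
        refine mul_le_mul_of_nonneg_right ((hφ _ _).trans_eq ?_) bernstein_nonneg
        rw [hxs, show R * (2 * (x : ℝ) - 1) - R * (2 * (k / N) - 1) = 2 * R * (x - k / N) by ring,
          abs_mul, abs_of_pos (by positivity : 0 < 2 * R)]
        ring
    _ ≤ K * (2 * R) * (1 / (2 * √N)) := by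
        rw [← mul_sum]
        exact mul_le_mul_of_nonneg_left (sum_abs_sub_mul_bernstein_le hN x) (by positivity)
    _ = K * R / √N := by
        have : (0 : ℝ) < √N := by positivity
        field_simp

end BernsteinApproximation

section Indistinguishability

/-- Multiplying `F` by a function bounded by `1` that depends on at most `d - c` attributes, the
label among them, gives a statistic whose totals over `Dr` and `Ds` differ by at most `E`. -/
def CloseTotals {m n : ℕ} (d : ℕ) (E : ℝ) (Dr Ds : Fin n → Fin (m+1) → ℝ) (c : ℕ)
    (F : (Fin (m+1) → ℝ) → ℝ) : Prop :=
  ∀ q : Finset (Fin (m+1)), Fin.last m ∈ q → q.card + c ≤ d →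
    ∀ g : (Fin (m+1) → ℝ) → ℝ, (∀ v v', (∀ j ∈ q, v j = v' j) → g v = g v') →
      (∀ v, (∀ j, |v j| ≤ 1) → |g v| ≤ 1) →
        |∑ i, g (Dr i) * F (Dr i) - ∑ i, g (Ds i) * F (Ds i)| ≤ E

variable {m n d : ℕ} {Ω : Fin (m+1) → Finset ℝ} {Dr Ds : Fin n → Fin (m+1) → ℝ} {E : ℝ}

theorem ValidDomains.abs_le_one (hΩ : ValidDomains m Ω) {j : Fin (m+1)} {x : ℝ} (hx : x ∈ Ω j) :
    |x| ≤ 1 :=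
  abs_le.2 (hΩ.1 j hx)

theorem closeTotals_one (hΩ : ValidDomains m Ω) (hr : ValidDataset Ω Dr) (hs : ValidDataset Ω Ds)
    (hE : ∀ q : Finset (Fin (m+1)), q.Nonempty → q.card ≤ d → margL1 Ω Dr Ds q ≤ E) :
    CloseTotals d E Dr Ds 0 fun _ => 1 := by
  classical
  intro q hq hqd g hg hg1
  set f : (∀ j ∈ q, ℝ) → ℝ := fun t => g fun j => if h : j ∈ q then t j h else 0 with hf
  have hfg : ∀ v, g v = f (fun j _ => v j) := fun v =>
    hg _ _ fun j hj => by simp [hj]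
  simp only [mul_one, hfg]
  refine (abs_sum_sub_sum_le_margL1 hr hs q f fun t ht => hg1 _ fun j => ?_).trans
    (hE q ⟨_, hq⟩ hqd)
  split_ifs with h
  · exact hΩ.abs_le_one (mem_pi.1 ht j h)
  · simp

theorem CloseTotals.mul_affine {c : ℕ} {F : (Fin (m+1) → ℝ) → ℝ}
    (hF : CloseTotals d E Dr Ds c F) {α : Fin m → ℝ} (hα : ∑ j, |α j| ≤ 1) :
    CloseTotals d E Dr Ds (c + 1) fun v =>
      (1 + (∑ j, α j * v j.castSucc) * v (Fin.last m)) / 2 * F v := by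
  classical
  intro q hq hqd g hg hg1
  have hE : 0 ≤ E := (abs_nonneg _).trans (hF q hq (by omega) g hg hg1)
  have h0 := hF q hq (by omega) g hg hg1
  have hj : ∀ j : Fin m, |∑ i, (g (Dr i) * (Dr i j.castSucc * Dr i (Fin.last m))) * F (Dr i) -
      ∑ i, (g (Ds i) * (Ds i j.castSucc * Ds i (Fin.last m))) * F (Ds i)| ≤ E := fun j => by
    refine hF (insert j.castSucc q) (mem_insert_of_mem hq)
      (by have := card_insert_le j.castSucc q; omega)
      (fun v => g v * (v j.castSucc * v (Fin.last m))) (fun v v' h => ?_) (fun v hv => ?_)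
    · rw [hg v v' fun i hi => h i (mem_insert_of_mem hi), h _ (mem_insert_self _ _),
        h _ (mem_insert_of_mem hq)]
    · rw [abs_mul, abs_mul]
      exact mul_le_one₀ (hg1 v hv) (by positivity) (mul_le_one₀ (hv _) (abs_nonneg _) (hv _))
  have hexp : ∀ D : Fin n → Fin (m+1) → ℝ,
      ∑ i, g (D i) * ((1 + (∑ j, α j * D i j.castSucc) * D i (Fin.last m)) / 2 * F (D i)) =
        (∑ i, g (D i) * F (D i) + ∑ j, α j *
          ∑ i, (g (D i) * (D i j.castSucc * D i (Fin.last m))) * F (D i)) / 2 := fun D => by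
    simp only [mul_sum, sum_mul]
    rw [sum_comm, ← sum_add_distrib, sum_div]
    refine sum_congr rfl fun i _ => ?_
    have : ∑ j, α j * (g (D i) * (D i j.castSucc * D i (Fin.last m)) * F (D i)) =
        g (D i) * F (D i) * ∑ j, α j * D i j.castSucc * D i (Fin.last m) := by
      rw [mul_sum]; exact sum_congr rfl fun j _ => by ring
    rw [this]
    ring
  simp only [hexp]
  rw [← sub_div, abs_div, abs_of_pos (zero_lt_two' ℝ), div_le_iff₀ zero_lt_two, add_sub_add_comm]
  refine (abs_add_le _ _).trans ?_
  have h2 : |∑ j, α j * ∑ i, (g (Dr i) * (Dr i j.castSucc * Dr i (Fin.last m))) * F (Dr i) -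
      ∑ j, α j * ∑ i, (g (Ds i) * (Ds i j.castSucc * Ds i (Fin.last m))) * F (Ds i)| ≤ E := by
    calc _ ≤ ∑ j, |α j| * E := by
          rw [← sum_sub_distrib]
          refine (abs_sum_le_sum_abs _ _).trans (sum_le_sum fun j _ => ?_)
          rw [← mul_sub, abs_mul]
          exact mul_le_mul_of_nonneg_left (hj j) (abs_nonneg _)
      _ ≤ E := by
          rw [← sum_mul]
          exact mul_le_of_le_one_left hE hα
  linarith

theorem closeTotals_bernstein (hΩ : ValidDomains m Ω) (hr : ValidDataset Ω Dr)
    (hs : ValidDataset Ω Ds)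
    (hE : ∀ q : Finset (Fin (m+1)), q.Nonempty → q.card ≤ d → margL1 Ω Dr Ds q ≤ E)
    {α : Fin m → ℝ} (hα : ∑ j, |α j| ≤ 1) (a b : ℕ) :
    CloseTotals d E Dr Ds (a + b) fun v =>
      ((1 + (∑ j, α j * v j.castSucc) * v (Fin.last m)) / 2) ^ a *
        ((1 - (∑ j, α j * v j.castSucc) * v (Fin.last m)) / 2) ^ b := by
  induction a with
  | zero =>
    induction b with
    | zero => simpa using closeTotals_one hΩ hr hs hE
    | succ b ih =>
      have h := ih.mul_affine (α := fun j => -α j) (by simpa using hα)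
      rw [← add_assoc]
      convert h using 1
      ext v
      simp only [neg_mul, sum_neg_distrib]
      ring
  | succ a ih =>
    have h := ih.mul_affine hα
    rw [Nat.add_right_comm]
    convert h using 1
    ext v
    ring

theorem abs_sum_bernstein_sub_le (hΩ : ValidDomains m Ω) (hr : ValidDataset Ω Dr)
    (hs : ValidDataset Ω Ds)
    (hE : ∀ q : Finset (Fin (m+1)), q.Nonempty → q.card ≤ d → margL1 Ω Dr Ds q ≤ E)
    {w : EuclideanSpace ℝ (Fin m)} {R : ℝ} (hR : 0 < R) (hw : ∑ j, |w j| ≤ R) {a b : ℕ}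
    (hab : a + b + 1 ≤ d) :
    |∑ i, ((1 + margin w (Dr i) / R) / 2) ^ a * ((1 - margin w (Dr i) / R) / 2) ^ b -
      ∑ i, ((1 + margin w (Ds i) / R) / 2) ^ a * ((1 - margin w (Ds i) / R) / 2) ^ b| ≤ E := by
  have hα : ∑ j, |w j / R| ≤ 1 := by
    simp only [abs_div, abs_of_pos hR]
    rw [← sum_div]
    exact div_le_one_of_le₀ hw hR.le
  have h := closeTotals_bernstein hΩ hr hs hE hα a b {Fin.last m} (mem_singleton_self _)
    (by rw [card_singleton]; omega) (fun _ => 1) (fun _ _ _ => rfl) (fun _ _ => by simp)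
  have hm : ∀ v : Fin (m+1) → ℝ,
      (∑ j, w j / R * v j.castSucc) * v (Fin.last m) = margin w v / R := fun v => by
    rw [margin, mul_div_right_comm, sum_div]
    congr 1
    exact sum_congr rfl fun j _ => by ring
  simpa only [one_mul, hm] using h

theorem abs_margin_le (hΩ : ValidDomains m Ω) {v : Fin (m+1) → ℝ} (hv : ∀ j, v j ∈ Ω j)
    {w : EuclideanSpace ℝ (Fin m)} {R : ℝ} (hw : ∑ j, |w j| ≤ R) : |margin w v| ≤ R := by
  rw [margin, abs_mul]
  refine (mul_le_of_le_one_right (abs_nonneg _) (hΩ.abs_le_one (hv _))).trans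
    ((abs_sum_le_sum_abs _ _).trans (le_trans (sum_le_sum fun j _ => ?_) hw))
  rw [abs_mul]
  exact mul_le_of_le_one_right (abs_nonneg _) (hΩ.abs_le_one (hv _))

theorem abs_risk_sub_risk_le (hΩ : ValidDomains m Ω) (hr : ValidDataset Ω Dr)
    (hs : ValidDataset Ω Ds) {N : ℕ} (hN : N ≠ 0) (hn : n ≠ 0)
    (hE : ∀ q : Finset (Fin (m+1)), q.Nonempty → q.card ≤ N + 1 → margL1 Ω Dr Ds q ≤ E)
    {w : EuclideanSpace ℝ (Fin m)} {R : ℝ} (hR : 0 < R) (hw : ∑ j, |w j| ≤ R) {φ : ℝ → ℝ} {K : ℝ}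
    (hK : 0 ≤ K) (hφ : ∀ x y, |φ x - φ y| ≤ K * |x - y|) :
    |risk φ w Dr - risk φ w Ds| ≤
      2 * (K * R / √N) + 1 / n * ((K * R + |φ 0|) * 2 ^ N * E) := by
  have hn' : (0 : ℝ) < n := by positivity
  set P : ℝ → ℝ := fun s => ∑ k : Fin (N + 1), φ (R * (2 * (k / N) - 1)) *
      (N.choose k * (((1 + s / R) / 2) ^ (k : ℕ) * ((1 - s / R) / 2) ^ (N - k))) with hP
  have happ : ∀ D : Fin n → Fin (m+1) → ℝ, ValidDataset Ω D →
      |∑ i, φ (margin w (D i)) - ∑ i, P (margin w (D i))| ≤ n * (K * R / √N) := fun D hD => by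
    rw [← sum_sub_distrib]
    refine (abs_sum_le_sum_abs _ _).trans ((sum_le_sum fun i _ =>
      abs_sub_bernstein_sum_le hK hφ hR (abs_margin_le hΩ (hD i) hw) hN).trans_eq ?_)
    simp
  have hφb : ∀ k : Fin (N + 1), |φ (R * (2 * (k / N) - 1))| ≤ K * R + |φ 0| := fun k => by
    have h1 := hφ (R * (2 * (k / N) - 1)) 0
    have hk0 : (0 : ℝ) ≤ k / N := by positivity
    have hk1 : (k : ℝ) / N ≤ 1 :=
      div_le_one_of_le₀ (by exact_mod_cast Nat.lt_succ_iff.1 k.2) (by positivity)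
    have h2 : |R * (2 * ((k : ℝ) / N) - 1) - 0| ≤ R := by
      rw [sub_zero, abs_mul, abs_of_pos hR]
      exact mul_le_of_le_one_right hR.le (abs_le.2 ⟨by linarith, by linarith⟩)
    have h3 := abs_sub_abs_le_abs_sub (φ (R * (2 * (k / N) - 1))) (φ 0)
    nlinarith [mul_le_mul_of_nonneg_left h2 hK]
  have hpoly : |∑ i, P (margin w (Dr i)) - ∑ i, P (margin w (Ds i))| ≤
      (K * R + |φ 0|) * 2 ^ N * E := by
    simp only [hP]
    rw [sum_comm, sum_comm (s := univ (α := Fin n)), ← sum_sub_distrib]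
    simp only [← mul_sum, ← mul_sub]
    calc _ ≤ ∑ k : Fin (N + 1), (K * R + |φ 0|) * (N.choose k * E) := by
          refine (abs_sum_le_sum_abs _ _).trans (sum_le_sum fun k _ => ?_)
          rw [abs_mul, abs_mul, Nat.abs_cast]
          gcongr
          · exact hφb k
          · exact abs_sum_bernstein_sub_le hΩ hr hs hE hR hw (by have := k.2; omega)
      _ = (K * R + |φ 0|) * 2 ^ N * E := by
          rw [← mul_sum, ← sum_mul, ← mul_assoc]
          congr 2
          have := Nat.sum_range_choose N
          rw [Finset.sum_range] at this
          exact_mod_cast this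
  have h1 := happ Dr hr
  have h2 := happ Ds hs
  rw [risk, risk, ← mul_sub, abs_mul, abs_of_pos (by positivity : (0 : ℝ) < 1 / n)]
  have h3 : |∑ i, φ (margin w (Dr i)) - ∑ i, φ (margin w (Ds i))| ≤
      n * (K * R / √N) + (K * R + |φ 0|) * 2 ^ N * E + n * (K * R / √N) := by
    rw [abs_le] at *
    constructor <;> linarith [h1.1, h1.2, h2.1, h2.2, hpoly.1, hpoly.2]
  calc _ ≤ 1 / (n : ℝ) *
        (n * (K * R / √N) + (K * R + |φ 0|) * 2 ^ N * E + n * (K * R / √N)) := by gcongr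
    _ = _ := by field_simp; ring

theorem sum_abs_le_mul_sqrt {τ : ℝ} {w : EuclideanSpace ℝ (Fin m)} (hw : ‖w‖ ≤ τ) :
    ∑ j, |w j| ≤ τ * √m := by
  have h1 := sum_mul_sq_le_sq_mul_sq univ (fun j => |w j|) (fun _ : Fin m => (1 : ℝ))
  simp only [mul_one, sq_abs, one_pow, sum_const, card_univ, Fintype.card_fin, nsmul_eq_mul] at h1
  have h2 : ∑ j, |w j| ≤ ‖w‖ * √m := by
    rw [EuclideanSpace.norm_eq, ← sqrt_mul (by positivity)]
    exact le_sqrt_of_sq_le (by simpa using h1)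
  exact h2.trans (by gcongr)

end Indistinguishability

section NoiseBounds

instance (m d : ℕ) (Ω : Fin (m+1) → Finset ℝ) (σ : ℝ) :
    IsProbabilityMeasure (noiseMeasure m d Ω σ) := by
  unfold noiseMeasure; infer_instance

theorem noiseMeasure_lt_abs_le {m d : ℕ} {Ω : Fin (m+1) → Finset ℝ} {σ s : ℝ} (hσ : 0 < σ)
    (hs : 0 ≤ s) (p : MargIdx m d Ω) :
    noiseMeasure m d Ω σ {z | s * σ < |z p|} ≤ ENNReal.ofReal (exp (-s ^ 2 / 2)) := by
  have hv : Real.toNNReal (σ ^ 2) ≠ 0 := by simpa using hσ.ne'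
  have hu : 0 ≤ s * σ := by positivity
  have h1 : noiseMeasure m d Ω σ {z | s * σ < |z p|} =
      gaussianReal 0 (Real.toNNReal (σ ^ 2)) {x | s * σ < |x|} := by
    have hmp := measurePreserving_eval
      (fun _ : MargIdx m d Ω => gaussianReal 0 (Real.toNNReal (σ ^ 2))) p
    exact hmp.measure_preimage
      (measurableSet_lt measurable_const measurable_id.abs).nullMeasurableSet
  have h2 : {x : ℝ | s * σ < |x|} = Set.Ioi (s * σ) ∪ Set.Iio (-(s * σ)) := by
    ext x
    simp only [Set.mem_ofPred_eq, lt_abs, Set.mem_union, Set.mem_Ioi, Set.mem_Iio, lt_neg]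
  have h4 := gaussianReal_Ioi_le hv hu
  have h5 : -(s * σ) ^ 2 / (2 * (Real.toNNReal (σ ^ 2) : ℝ)) = -s ^ 2 / 2 := by
    rw [Real.coe_toNNReal _ (sq_nonneg σ)]
    field_simp
  rw [h5] at h4
  rw [h1, h2]
  refine (measure_union_le _ _).trans ?_
  rw [gaussianReal_Iio_neg]
  refine (add_le_add h4 h4).trans_eq ?_
  rw [← ENNReal.ofReal_add (by positivity) (by positivity), add_halves]

theorem le_noiseMeasure_forall_abs_le {m d l : ℕ} {Ω : Fin (m+1) → Finset ℝ} {σ lam : ℝ}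
    (hσ : 0 < σ) (hlam : 0 < lam) (hm : 1 ≤ m) (hl : 1 ≤ l)
    (hcard : Fintype.card (MargIdx m d Ω) ≤ m ^ d * l ^ d) :
    ENNReal.ofReal (1 - (2 : ℝ) ^ (-lam)) ≤ noiseMeasure m d Ω σ
      {z | ∀ p, |z p| ≤ √(2 * (log 2 * (1 + lam) + d * log (m * l))) * σ} := by
  set s := √(2 * (log 2 * (1 + lam) + d * log (m * l))) with hs
  have hml : (1 : ℝ) ≤ m * l := by exact_mod_cast Nat.mul_pos hm hl
  have hs2 : s ^ 2 = 2 * (log 2 * (1 + lam) + d * log (m * l)) := by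
    refine sq_sqrt ?_
    have := log_nonneg hml
    have := log_pos one_lt_two
    positivity
  have hmeas : MeasurableSet {z : MargIdx m d Ω → ℝ | ∀ p, |z p| ≤ s * σ} := by
    have : {z : MargIdx m d Ω → ℝ | ∀ p, |z p| ≤ s * σ} = ⋂ p, {z | |z p| ≤ s * σ} := by
      ext z; simp
    rw [this]
    exact MeasurableSet.iInter fun p =>
      measurableSet_le (measurable_pi_apply p).abs measurable_const
  have hcompl : noiseMeasure m d Ω σ {z | ∀ p, |z p| ≤ s * σ}ᶜ ≤
      ENNReal.ofReal ((2 : ℝ) ^ (-lam)) := by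
    have h1 : {z : MargIdx m d Ω → ℝ | ∀ p, |z p| ≤ s * σ}ᶜ = ⋃ p, {z | s * σ < |z p|} := by
      ext z; simp
    have hexp : exp (-s ^ 2 / 2) = (2 : ℝ) ^ (-lam) / 2 / (m * l) ^ d := by
      rw [hs2, show -(2 * (log 2 * (1 + lam) + d * log (m * l))) / 2 =
        log 2 * (-lam) - log 2 - d * log (m * l) by ring, exp_sub, exp_sub,
        ← rpow_def_of_pos two_pos, exp_log two_pos, ← log_pow, exp_log (by positivity)]
    rw [h1]
    calc _ ≤ ∑ p, noiseMeasure m d Ω σ {z | s * σ < |z p|} := measure_iUnion_fintype_le _ _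
      _ ≤ ∑ _p : MargIdx m d Ω, ENNReal.ofReal (exp (-s ^ 2 / 2)) :=
          sum_le_sum fun p _ => noiseMeasure_lt_abs_le hσ (sqrt_nonneg _) p
      _ = ENNReal.ofReal (Fintype.card (MargIdx m d Ω) * exp (-s ^ 2 / 2)) := by
          rw [sum_const, nsmul_eq_mul, Finset.card_univ, ENNReal.ofReal_mul (by positivity),
            ENNReal.ofReal_natCast]
      _ ≤ _ := by
          refine ENNReal.ofReal_le_ofReal ?_
          have h2 : (Fintype.card (MargIdx m d Ω) : ℝ) ≤ (m * l) ^ d := by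
            rw [mul_pow]; exact_mod_cast hcard
          have h3 : (0 : ℝ) < (m * l) ^ d := by positivity
          have h4 : (0 : ℝ) < 2 ^ (-lam) := by positivity
          rw [hexp, mul_div_assoc', div_le_iff₀ h3]
          nlinarith
  rw [prob_compl_eq_one_sub hmeas] at hcompl
  rw [ENNReal.ofReal_sub _ (by positivity), ENNReal.ofReal_one]
  exact tsub_le_iff_tsub_le.1 hcompl

end NoiseBounds

section Mechanism

theorem map_sel_le_of_adjacent {m n d : ℕ} {Ω : Fin (m+1) → Finset ℝ} {ε δ σ : ℝ}
    (hε : ε ∈ Set.Ioo (0 : ℝ) 1) (hδ : δ ∈ Set.Ioo (0 : ℝ) 1) (hσ : 0 < σ)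
    (hσ2 : 4 * m ^ d * log (1.25 / δ) ≤ ε ^ 2 * σ ^ 2)
    (hcard : Fintype.card {q : Finset (Fin (m+1)) // q.Nonempty ∧ q.card ≤ d} ≤ m ^ d)
    {sel : (MargIdx m d Ω → ℝ) → (Fin n → Fin (m+1) → ℝ)} (hsel : Measurable sel)
    {D D' : Fin n → Fin (m+1) → ℝ} (h : Adjacent D D')
    {S : Set (Fin n → Fin (m+1) → ℝ)} (hS : MeasurableSet S) :
    Measure.map (fun z => sel (fun p => margVec Ω D p + z p)) (noiseMeasure m d Ω σ) S ≤
      ENNReal.ofReal (exp ε) *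
        Measure.map (fun z => sel (fun p => margVec Ω D' p + z p)) (noiseMeasure m d Ω σ) S +
      ENNReal.ofReal δ := by
  have hv : Real.toNNReal (σ ^ 2) ≠ 0 := by simpa using hσ.ne'
  have hm : ∀ D : Fin n → Fin (m+1) → ℝ,
      Measurable fun z : MargIdx m d Ω → ℝ => sel (fun p => margVec Ω D p + z p) := fun D =>
    hsel.comp (by fun_prop)
  rw [Measure.map_apply (hm D) hS, Measure.map_apply (hm D') hS]
  set a : MargIdx m d Ω → ℝ := fun p => margVec Ω D p - margVec Ω D' p with ha
  have hT := (hm D') hS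
  have hlog : 0 ≤ log (1.25 / δ) := log_nonneg (by
    rw [le_div_iff₀ hδ.1]; linarith [hδ.2])
  have hA : ∑ p, a p ^ 2 ≤ 2 * m ^ d :=
    (sum_sq_margVec_sub_le Ω h).trans (by gcongr; exact_mod_cast hcard)
  have key := pi_gaussianReal_shift_le_of_sensitivity a hv hε hδ (by
    rw [Real.coe_toNNReal _ (sq_nonneg σ)]
    nlinarith [mul_le_mul_of_nonneg_left hA hlog]) hT
  rw [Measure.map_apply (by fun_prop) hT] at key
  refine le_trans (le_of_eq ?_) key
  rw [noiseMeasure]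
  congr 1
  ext z
  simp only [Set.mem_preimage, ha]
  refine iff_of_eq ?_
  congr 3
  ext p
  ring

theorem excess_risk_le {m n : ℕ} {φ : ℝ → ℝ} {Dr Ds : Fin n → Fin (m+1) → ℝ} {B τ : ℝ}
    {wr ws : EuclideanSpace ℝ (Fin m)} (hwr : ‖wr‖ ≤ τ) (hws : ‖ws‖ ≤ τ)
    (hr : ∀ w : EuclideanSpace ℝ (Fin m), ‖w‖ ≤ τ → risk φ wr Dr ≤ risk φ w Dr)
    (hs : ∀ w : EuclideanSpace ℝ (Fin m), ‖w‖ ≤ τ → risk φ ws Ds ≤ risk φ w Ds)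
    (hB : ∀ w : EuclideanSpace ℝ (Fin m), ‖w‖ ≤ τ → |risk φ w Dr - risk φ w Ds| ≤ B) :
    |risk φ ws Dr - risk φ wr Dr| ≤ 2 * B := by
  rw [abs_of_nonneg (sub_nonneg.2 (hr ws hws))]
  linarith [hs wr hwr, (abs_le.1 (hB ws hws)).2, (abs_le.1 (hB wr hwr)).1]

end Mechanism

/-- end-to-end guarantee of the mechanism `Gen_{d,σ}`: (a) it is
`(ε,δ)`-DP, and (b) with probability at least `1 − 2^{−λ}` the excess empirical
risk of any continuous `K`-Lipschitz loss is bounded. -/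
theorem gen_mechanism_dp_and_excess_risk_lipschitz :
    ∃ C : ℝ, 0 < C ∧
      ∀ (m n d : ℕ), 1 ≤ m → 1 ≤ n → 2 ≤ d → d ≤ m + 1 →
      Fintype.card {q : Finset (Fin (m+1)) // q.Nonempty ∧ q.card ≤ d} ≤ m ^ d →
      ∀ (K lam ε δ τ : ℝ), 0 < K → 0 < lam → ε ∈ Set.Ioo (0:ℝ) 1 → δ ∈ Set.Ioo (0:ℝ) 1 →
        0 < τ → 1 ≤ τ * Real.sqrt m →
      ∀ (Ω : Fin (m+1) → Finset ℝ), ValidDomains m Ω →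
      ∀ l : ℕ, l = (Finset.univ.sup fun j : Fin (m+1) => (Ω j).card) →
      ∀ σ : ℝ, σ = 2 * (m : ℝ) ^ ((d : ℝ) / 2) * Real.sqrt (Real.log (1.25 / δ)) / ε →
      ∀ (φ : ℝ → ℝ), Continuous φ → LipschitzWith (Real.toNNReal K) φ →
      ∀ sel : (MargIdx m d Ω → ℝ) → (Fin n → Fin (m+1) → ℝ),
        Measurable sel →
        (∀ h : MargIdx m d Ω → ℝ, ValidDataset Ω (sel h)) →
        (∀ (h : MargIdx m d Ω → ℝ) (D : Fin n → Fin (m+1) → ℝ), ValidDataset Ω D →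
          maxDistToMarginals Ω h (sel h) ≤ maxDistToMarginals Ω h D) →
      ∀ Dr : Fin n → Fin (m+1) → ℝ, ValidDataset Ω Dr →
      -- (a) differential privacy of the mechanism
      ((∀ Dr' : Fin n → Fin (m+1) → ℝ, ValidDataset Ω Dr' → Adjacent Dr Dr' →
        ∀ S : Set (Fin n → Fin (m+1) → ℝ), MeasurableSet S →
          Measure.map (fun z => sel (fun p => margVec Ω Dr p + z p)) (noiseMeasure m d Ω σ) S ≤
            ENNReal.ofReal (Real.exp ε) *
              Measure.map (fun z => sel (fun p => margVec Ω Dr' p + z p))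
                (noiseMeasure m d Ω σ) S + ENNReal.ofReal δ) ∧
      -- (b) excess empirical risk bound, with probability ≥ 1 − 2^{−λ}
      (∀ wr : EuclideanSpace ℝ (Fin m), ‖wr‖ ≤ τ →
        (∀ w : EuclideanSpace ℝ (Fin m), ‖w‖ ≤ τ → risk φ wr Dr ≤ risk φ w Dr) →
        ∀ wsel : (Fin n → Fin (m+1) → ℝ) → EuclideanSpace ℝ (Fin m),
          (∀ D : Fin n → Fin (m+1) → ℝ, ‖wsel D‖ ≤ τ ∧
            ∀ w : EuclideanSpace ℝ (Fin m), ‖w‖ ≤ τ → risk φ (wsel D) D ≤ risk φ w D) →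
          noiseMeasure m d Ω σ
              {z : MargIdx m d Ω → ℝ |
                |risk φ (wsel (sel (fun p => margVec Ω Dr p + z p))) Dr - risk φ wr Dr| ≤
                  C * (K * τ * Real.sqrt ((m : ℝ) / ((d : ℝ) - 1)) +
                    (1 / (n : ℝ)) * (K * τ * Real.sqrt (m : ℝ) + |φ 0|) *
                      (3 * (m : ℝ) * max 1 τ) ^ (d - 1) *
                      (2 * (l : ℝ) ^ d *
                        Real.sqrt (2 * (Real.log 2 * (1 + lam) + (d : ℝ) * Real.log (m * l))) *
                        σ))} ≥
            ENNReal.ofReal (1 - (2 : ℝ) ^ (-lam)))) := by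
  refine ⟨4, by norm_num, ?_⟩
  intro m n d hm hn hd hdm hcard K lam ε δ τ hK hlam hε hδ hτ hτm Ω hΩ l hl σ hσ φ _ hφ sel
    hsel hval hmin Dr hDr
  have hlc : ∀ j, (Ω j).card ≤ l := fun j => hl ▸ le_sup (f := fun j => (Ω j).card) (mem_univ j)
  have hl1 : 1 ≤ l := by
    have h1 := hlc (Fin.last m)
    rw [hΩ.2, card_pair (by norm_num)] at h1
    omega
  have hm0 : (0 : ℝ) < m := by exact_mod_cast hm
  have hlog : 0 < log (1.25 / δ) := log_pos (by
    rw [lt_div_iff₀ hδ.1]; linarith [hδ.2])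
  have hε0 := hε.1
  have hσ0 : 0 < σ := by rw [hσ]; positivity
  have hσ2 : ε ^ 2 * σ ^ 2 = 4 * m ^ d * log (1.25 / δ) := by
    have h1 : ((m : ℝ) ^ ((d : ℝ) / 2)) ^ 2 = m ^ d := by
      rw [← rpow_natCast, ← rpow_mul hm0.le, ← rpow_natCast]
      congr 1
      push_cast
      ring
    rw [hσ, div_pow, mul_pow, mul_pow, sq_sqrt hlog.le, h1]
    field_simp
    ring
  refine ⟨fun Dr' _ hadj S hS =>
    map_sel_le_of_adjacent hε hδ hσ0 hσ2.ge hcard hsel hadj hS, ?_⟩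
  intro wr hwr hwrmin wsel hwsel
  have hcard' : Fintype.card (MargIdx m d Ω) ≤ m ^ d * l ^ d :=
    (card_margIdx_le hlc hl1).trans (by gcongr)
  refine (le_noiseMeasure_forall_abs_le hσ0 hlam hm hl1 hcard').trans (measure_mono fun z hz => ?_)
  set s := √(2 * (log 2 * (1 + lam) + d * log (m * l))) with hs
  have hs0 : 0 ≤ s := sqrt_nonneg _
  set Ds := sel (fun p => margVec Ω Dr p + z p) with hDs
  obtain ⟨N, rfl⟩ : ∃ N, d = N + 1 := ⟨d - 1, by omega⟩
  have hN : N ≠ 0 := by omega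
  have hE : ∀ q : Finset (Fin (m+1)), q.Nonempty → q.card ≤ N + 1 →
      margL1 Ω Dr Ds q ≤ 2 * l ^ (N + 1) * (s * σ) := fun q hq hqd =>
    margL1_le_of_minimizer hlc hl1 (by omega) (by positivity) hz (hmin _ Dr hDr) hq hqd
  have hφ' : ∀ x y, |φ x - φ y| ≤ K * |x - y| := fun x y => by
    have h1 := hφ.dist_le_mul x y
    rwa [Real.coe_toNNReal _ hK.le, Real.dist_eq, Real.dist_eq] at h1
  have hR : 0 < τ * √m := by positivity
  have h1 := excess_risk_le hwr (hwsel Ds).1 hwrmin (hwsel Ds).2 fun w hw =>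
    abs_risk_sub_risk_le hΩ hDr (hval _) hN (by omega) hE hR (sum_abs_le_mul_sqrt hw) hK.le hφ'
  refine h1.trans ?_
  have h2 : τ * √m / √N = τ * √(m / ((N + 1 : ℕ) - 1)) := by
    rw [Nat.cast_succ, add_sub_cancel_right, sqrt_div hm0.le, mul_div_assoc]
  have h3 : (2 : ℝ) ^ N ≤ (3 * m * max 1 τ) ^ N := by
    refine pow_le_pow_left₀ (by norm_num) ?_ N
    have h4 : (1 : ℝ) ≤ m := by exact_mod_cast hm
    nlinarith [le_max_left 1 τ]
  have h5 : 1 / (n : ℝ) * ((K * (τ * √m) + |φ 0|) * 2 ^ N * (2 * l ^ (N + 1) * (s * σ))) ≤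
      1 / (n : ℝ) * (K * τ * √m + |φ 0|) * (3 * m * max 1 τ) ^ N *
        (2 * l ^ (N + 1) * s * σ) := by
    rw [← mul_assoc K, mul_assoc (1 / (n : ℝ)), mul_assoc (1 / (n : ℝ)), mul_assoc (2 * _) s]
    gcongr
  have h6 : 0 ≤ 1 / (n : ℝ) * (K * τ * √m + |φ 0|) * (3 * m * max 1 τ) ^ N *
        (2 * l ^ (N + 1) * s * σ) := by positivity
  have h7 : K * (τ * √m) / √N = K * τ * √(m / ((N + 1 : ℕ) - 1)) := by
    rw [mul_div_assoc, h2, mul_assoc]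
  rw [add_tsub_cancel_right, h7]
  linarith
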